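/- Let V, H : ℤ → ℕ be functions such that V is nonincreasing, H is nondecreasing, and V(0) = H(0) = 0. Let p, q be coprime integers with p > 0 and q < 0, and let i be an integer with 0 ≤ i ≤ p−1. Then the map D = D_{i,p/q} : ⊕_{s∈ℤ} T⁺ → ⊕_{s∈ℤ} T⁺ is injective. -/

import Mathlib

/-- `T⁺ = 𝔽₂[U,U⁻¹]/U·𝔽₂[U]`, modeled as finitely supported functions `ℕ → 𝔽₂`. -/
abbrev Tplus : Type := ℕ →₀ ZMod 2

/-- The action of `U^m` on `T⁺`: `(U^m f)(n) = f(n + m)`. -/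
noncomputable def Upow (m : ℕ) : Tplus →ₗ[ZMod 2] Tplus :=
  Finsupp.lcomapDomain (· + m) (add_left_injective m)

theorem Upow_zero_apply (f : Tplus) : Upow 0 f = f := by
  ext n
  simp [Upow, Finsupp.lcomapDomain]

/-- A finitely supported function on `ℤ` vanishes outside a bounded interval. -/
theorem exists_nat_forall_natAbs_ge_eq_zero {M : Type*} [Zero M] (a : ℤ →₀ M) :
    ∃ N : ℕ, ∀ s : ℤ, N ≤ s.natAbs → a s = 0 := by
  refine ⟨a.support.sup Int.natAbs + 1, fun s hs => ?_⟩
  by_contra h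
  have := Finset.le_sup (f := Int.natAbs) (Finsupp.mem_support_iff.mpr h)
  omega

/-- A finitely supported function on `ℤ` whose zeros propagate downwards to every `s ≥ 0`
vanishes on `s ≥ 0`. -/
theorem eq_zero_of_nonneg_of_succ {M : Type*} [Zero M] (a : ℤ →₀ M)
    (h : ∀ s : ℤ, 0 ≤ s → a (s + 1) = 0 → a s = 0) (s : ℤ) (hs : 0 ≤ s) : a s = 0 := by
  obtain ⟨N, hN⟩ := exists_nat_forall_natAbs_ge_eq_zero a
  have key : ∀ (n : ℕ) (t : ℤ), 0 ≤ t → N ≤ t + n → a t = 0 := by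
    intro n
    induction n with
    | zero => exact fun t ht hle => hN t (by omega)
    | succ n ih => exact fun t ht hle => h t ht (ih (t + 1) (by omega) (by push_cast at hle; omega))
  exact key N s hs (by omega)

/-- A finitely supported function on `ℤ` whose zeros propagate upwards to every `s < 0`
vanishes on `s < 0`. -/
theorem eq_zero_of_neg_of_pred {M : Type*} [Zero M] (a : ℤ →₀ M)
    (h : ∀ s : ℤ, s < 0 → a (s - 1) = 0 → a s = 0) (s : ℤ) (hs : s < 0) : a s = 0 := by
  obtain ⟨N, hN⟩ := exists_nat_forall_natAbs_ge_eq_zero a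
  have key : ∀ (n : ℕ) (t : ℤ), t < 0 → t ≤ n - N → a t = 0 := by
    intro n
    induction n with
    | zero => exact fun t ht hle => hN t (by omega)
    | succ n ih => exact fun t ht hle => h t ht (ih (t - 1) (by omega) (by push_cast at hle; omega))
  exact key N s hs (by omega)

/-- Injectivity of the map `D^T_{i,p/q} : ⊕_{s∈ℤ} T⁺ → ⊕_{s∈ℤ} T⁺` of the rational surgery
mapping cone for a negative slope `p/q < 0` when `V₀ = H₀ = 0` (the abstract form of the
injectivity assertion in the negative-slope case of Lemma 5.2 of Ni–Wu). -/
theorem D_injective_of_neg_slope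
    (V H : ℤ → ℕ) (hV : Antitone V) (hH : Monotone H)
    (hV0 : V 0 = 0) (hH0 : H 0 = 0)
    (p q : ℤ) (hp : 0 < p) (hq : q < 0) (hpq : Int.gcd p q = 1)
    (i : ℤ) (hi0 : 0 ≤ i) (hip : i ≤ p - 1)
    (D : (ℤ →₀ Tplus) →ₗ[ZMod 2] (ℤ →₀ Tplus))
    (hD : ∀ (a : ℤ →₀ Tplus) (s : ℤ),
      D a s = Upow (V ⌊((i : ℚ) + (p : ℚ) * (s : ℚ)) / (q : ℚ)⌋) (a s)
        + Upow (H ⌊((i : ℚ) + (p : ℚ) * ((s : ℚ) - 1)) / (q : ℚ)⌋) (a (s - 1))) :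
    Function.Injective D := by
  have hq' : (q : ℚ) < 0 := by exact_mod_cast hq
  have hVfloor : ∀ s : ℤ, s < 0 → V ⌊((i : ℚ) + (p : ℚ) * (s : ℚ)) / (q : ℚ)⌋ = 0 := by
    intro s hs
    have hnum : i + p * s ≤ 0 := by nlinarith
    have hnum' : (i : ℚ) + p * s ≤ 0 := by exact_mod_cast hnum
    exact Nat.le_zero.mp (hV0 ▸ hV (Int.floor_nonneg.mpr (div_nonneg_of_nonpos hnum' hq'.le)))
  have hHfloor : ∀ s : ℤ, 0 ≤ s → H ⌊((i : ℚ) + (p : ℚ) * (s : ℚ)) / (q : ℚ)⌋ = 0 := by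
    intro s hs
    have hnum : 0 ≤ i + p * s := by positivity
    have hnum' : 0 ≤ (i : ℚ) + p * s := by exact_mod_cast hnum
    exact Nat.le_zero.mp (hH0 ▸ hH
      (Int.floor_le_floor (div_nonpos_of_nonneg_of_nonpos hnum' hq'.le) |>.trans_eq Int.floor_zero))
  rw [injective_iff_map_eq_zero]
  intro a ha
  have hDa : ∀ s, D a s = 0 := fun s => by rw [ha, Finsupp.zero_apply]
  ext1 s
  rw [Finsupp.zero_apply]
  rcases lt_or_ge s 0 with hs | hs
  · refine eq_zero_of_neg_of_pred a (fun t ht hat => ?_) s hs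
    have := hDa t
    rwa [hD, hat, map_zero, add_zero, hVfloor t ht, Upow_zero_apply] at this
  · refine eq_zero_of_nonneg_of_succ a (fun t ht hat => ?_) s hs
    have := hDa (t + 1)
    rwa [hD, hat, map_zero, zero_add, add_sub_cancel_right, Int.cast_add, Int.cast_one,
      add_sub_cancel_right, hHfloor t ht, Upow_zero_apply] at this
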